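/- arXiv:1811.07264 — 7 statements merged into one kernel-verified Lean document; each statement's English description precedes it below -/
import Mathlib

section
/- Let f : ℝⁿ → ℝ be a C¹ function with V := f⁻¹(0) ≠ ∅. Suppose there exist constants c₀ > 0, δ > 0 and R > 0 with δ < c₀/3 and R ≥ dist(0, V), such that ‖x‖·‖∇f(x)‖ ≥ c₀ whenever ‖x‖ ≥ R and |f(x)| ≤ δ. Then for every x ∈ ℝⁿ with ‖x‖ ≥ 2R and |f(x)| ≤ δ, one has ‖x‖·|f(x)| ≥ (2c₀/5)·dist(x, V). -/
open Filter Metric Real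

section

variable {E : Type*} [NormedAddCommGroup E] [NormedSpace ℝ E]

/-- If `g` decreases at rate at most `k` around `y`, its derivative at `y` has norm at most `k`. -/
theorem norm_fderiv_le_of_eventually_le {g : E → ℝ} {g' : E →L[ℝ] ℝ} {y : E} {k : ℝ} (hk : 0 ≤ k)
    (hg : HasFDerivAt g g' y) (h : ∀ᶠ z in nhds y, g y ≤ g z + k * ‖z - y‖) : ‖g'‖ ≤ k := by
  have key : ∀ v : E, -(k * ‖v‖) ≤ g' v := by
    intro v
    have hline : HasDerivAt (fun t : ℝ => g (y + t • v)) (g' v) 0 := by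
      have := hg.hasLineDerivAt v
      exact this
    have hslope := hline.tendsto_slope_zero_right
    have hcont : Tendsto (fun t : ℝ => y + t • v) (nhdsWithin 0 (Set.Ioi 0)) (nhds y) := by
      have hc : Continuous (fun t : ℝ => y + t • v) := by fun_prop
      simpa using (hc.tendsto 0).mono_left (nhdsWithin_le_nhds (s := Set.Ioi 0))
    refine ge_of_tendsto hslope ?_
    filter_upwards [hcont.eventually h, self_mem_nhdsWithin] with t ht ht0
    have ht0 : 0 < t := ht0
    rw [add_sub_cancel_left, norm_smul, Real.norm_of_nonneg ht0.le] at ht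
    simp only [zero_add, zero_smul, add_zero, smul_eq_mul]
    rw [inv_mul_eq_div, le_div_iff₀ ht0]
    linarith
  refine g'.opNorm_le_bound hk fun v => ?_
  rw [Real.norm_eq_abs, abs_le]
  refine ⟨key v, ?_⟩
  have := key (-v)
  rw [norm_neg, map_neg] at this
  linarith

/-- If `|f|` decreases at rate at most `k` around a point `y` where `f` does not vanish,
the derivative of `f` at `y` has norm at most `k`. -/
theorem norm_fderiv_le_of_eventually_abs_le {f : E → ℝ} {y : E} {k : ℝ} (hk : 0 ≤ k)
    (hf : DifferentiableAt ℝ f y) (hy : f y ≠ 0)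
    (h : ∀ᶠ z in nhds y, |f y| ≤ |f z| + k * ‖z - y‖) : ‖fderiv ℝ f y‖ ≤ k := by
  rcases lt_or_gt_of_ne hy with hneg | hpos
  · rw [← norm_neg]
    exact norm_fderiv_le_of_eventually_le hk (hf.hasFDerivAt.abs_of_neg hneg) h
  · exact norm_fderiv_le_of_eventually_le hk (hf.hasFDerivAt.abs_of_pos hpos) h

/-- A penalized minimum of `|f|` over a ball on which `f` does not vanish is a point with
small derivative. -/
theorem exists_norm_fderiv_le_of_abs_lt [ProperSpace E] {f : E → ℝ} (hf : Differentiable ℝ f)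
    {x : E} {k r : ℝ} (hk : 0 ≤ k) (hr : 0 < r) (hx : |f x| < k * r)
    (hne : ∀ y ∈ ball x r, f y ≠ 0) :
    ∃ y ∈ ball x r, |f y| ≤ |f x| ∧ ‖fderiv ℝ f y‖ ≤ k := by
  have hc : Continuous fun z => |f z| + k * ‖z - x‖ := by
    have := hf.continuous
    fun_prop
  obtain ⟨y, hyr, hmin⟩ := (isCompact_closedBall x r).exists_isMinOn
    ⟨x, mem_closedBall_self hr.le⟩ hc.continuousOn
  have hyx : |f y| + k * ‖y - x‖ ≤ |f x| := by
    simpa using hmin (mem_closedBall_self hr.le)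
  have hyb : y ∈ ball x r := by
    rw [mem_ball_iff_norm]
    by_contra! hcon
    nlinarith [abs_nonneg (f y), mul_le_mul_of_nonneg_left hcon hk]
  refine ⟨y, hyb, by linarith [mul_nonneg hk (norm_nonneg (y - x))], ?_⟩
  refine norm_fderiv_le_of_eventually_abs_le hk (hf y) (hne y hyb) ?_
  filter_upwards [isOpen_ball.mem_nhds hyb] with z hz
  have hz' : |f y| + k * ‖y - x‖ ≤ |f z| + k * ‖z - x‖ := hmin (ball_subset_closedBall hz)
  have htri := mul_le_mul_of_nonneg_left (norm_sub_le_norm_sub_add_norm_sub z y x) hk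
  linarith

end

/-- Inequality (1.4) of the paper: if `‖x‖ ‖∇f(x)‖ ≥ c₀` whenever `‖x‖ ≥ R` and
`|f x| ≤ δ` (with `δ < c₀/3` and `R ≥ dist(0, V)`, `V = f⁻¹(0) ≠ ∅`), then
`‖x‖ |f x| ≥ (2c₀/5) dist(x, V)` whenever `‖x‖ ≥ 2R` and `|f x| ≤ δ`. -/
theorem norm_mul_abs_ge_dist {n : ℕ} (f : EuclideanSpace ℝ (Fin n) → ℝ)
    (hf : ContDiff ℝ 1 f)
    (V : Set (EuclideanSpace ℝ (Fin n))) (hV : V = {x | f x = 0}) (hVne : V.Nonempty)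
    (c0 δ R : ℝ) (hc0 : 0 < c0) (hδ : 0 < δ) (hR : 0 < R)
    (hδc0 : δ < c0 / 3) (hRV : Metric.infDist (0 : EuclideanSpace ℝ (Fin n)) V ≤ R)
    (hgrad : ∀ x : EuclideanSpace ℝ (Fin n), R ≤ ‖x‖ → |f x| ≤ δ →
      c0 ≤ ‖x‖ * ‖gradient f x‖) :
    ∀ x : EuclideanSpace ℝ (Fin n), 2 * R ≤ ‖x‖ → |f x| ≤ δ →
      2 * c0 / 5 * Metric.infDist x V ≤ ‖x‖ * |f x| := by
  intro x hx hfx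
  by_contra! hlt
  have hfd : Differentiable ℝ f := hf.differentiable one_ne_zero
  have hrpos : 0 < ‖x‖ := by linarith
  have hd : 0 < Metric.infDist x V := by
    by_contra! hcon
    nlinarith [mul_nonneg hrpos.le (abs_nonneg (f x))]
  obtain ⟨s, hs, hsd, hsx, hlt'⟩ : ∃ s, 0 < s ∧ s ≤ Metric.infDist x V ∧ s ≤ ‖x‖ / 2 ∧
      (‖x‖ + s) * |f x| < c0 * s := by
    rcases le_or_gt (Metric.infDist x V) (‖x‖ / 2) with hle | hgt
    · refine ⟨_, hd, le_rfl, hle, ?_⟩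
      nlinarith [mul_le_mul_of_nonneg_right hle (abs_nonneg (f x)), mul_pos hc0 hd]
    · refine ⟨‖x‖ / 2, by linarith, hgt.le, le_rfl, ?_⟩
      nlinarith
  have hrs : 0 < ‖x‖ + s := by linarith
  obtain ⟨k, hk1, hk2⟩ : ∃ k, |f x| / s < k ∧ k < c0 / (‖x‖ + s) := by
    apply exists_between
    rw [div_lt_div_iff₀ hs hrs]
    linarith
  have hk : 0 ≤ k := (div_nonneg (abs_nonneg _) hs.le).trans hk1.le
  rw [div_lt_iff₀ hs] at hk1
  rw [lt_div_iff₀ hrs] at hk2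
  obtain ⟨y, hy, hfy, hdy⟩ := exists_norm_fderiv_le_of_abs_lt hfd hk hs hk1 fun y hy h0 => by
    have hyV : y ∈ V := by rw [hV]; exact h0
    have := Metric.infDist_le_dist_of_mem (x := x) hyV
    rw [mem_ball, dist_comm] at hy
    linarith
  rw [mem_ball_iff_norm] at hy
  have hyl : R ≤ ‖y‖ := by
    have := norm_sub_norm_le x y
    rw [norm_sub_rev] at this
    linarith
  have hyu : ‖y‖ ≤ ‖x‖ + s := by linarith [norm_sub_norm_le y x]
  have hgr : ‖gradient f y‖ = ‖fderiv ℝ f y‖ := by simp [gradient]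
  have hc := hgrad y hyl (hfy.trans hfx)
  rw [hgr] at hc
  have := mul_le_mul hyu hdy (norm_nonneg _) hrs.le
  linarith
end

section
/- Let f : ℝ² → ℝ be the Broughton polynomial f(x, y) := x(xy − 1) and V := f⁻¹(0). Then for every (x, y) ∈ ℝ² with |x| ≥ 1, one has dist((x, y), V) ≤ ‖(x, y)‖·|f(x, y)|. -/
open Filter Metric Real

/-- For the Broughton polynomial `f(x,y) = x(xy − 1)` and `V = f⁻¹(0)`:
if `|x| ≥ 1` then `dist((x,y), V) ≤ ‖(x,y)‖ |f(x,y)|`. -/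
theorem broughton_dist_le_of_abs_fst_ge_one :
    ∀ p : EuclideanSpace ℝ (Fin 2), 1 ≤ |p 0| →
      Metric.infDist p {q : EuclideanSpace ℝ (Fin 2) | q 0 * (q 0 * q 1 - 1) = 0}
        ≤ ‖p‖ * |p 0 * (p 0 * p 1 - 1)| := by
  intro p hp
  have hx : p 0 ≠ 0 := abs_pos.mp (by linarith)
  have hnorm : 1 ≤ ‖p‖ := hp.trans (PiLp.norm_apply_le p 0)
  have hmem : !₂[p 0, (p 0)⁻¹] ∈
      {q : EuclideanSpace ℝ (Fin 2) | q 0 * (q 0 * q 1 - 1) = 0} := by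
    simp [hx]
  have hf : p 0 * (p 0 * p 1 - 1) = p 0 ^ 2 * (p 1 - (p 0)⁻¹) := by
    field_simp
  calc
    _ ≤ dist p !₂[p 0, (p 0)⁻¹] := infDist_le_dist_of_mem hmem
    _ = |p 1 - (p 0)⁻¹| := by
      simp [EuclideanSpace.dist_eq, Real.dist_eq, Real.sqrt_sq_eq_abs]
    _ ≤ |p 0| ^ 2 * |p 1 - (p 0)⁻¹| :=
      le_mul_of_one_le_left (abs_nonneg _) (one_le_pow₀ hp)
    _ = |p 0 * (p 0 * p 1 - 1)| := by rw [hf, abs_mul, abs_pow]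
    _ ≤ ‖p‖ * |p 0 * (p 0 * p 1 - 1)| := le_mul_of_one_le_left (abs_nonneg _) hnorm
end

section
/- Let f : ℝ² → ℝ be the Broughton polynomial f(x, y) := x(xy − 1) and V := f⁻¹(0). Then for every (x, y) ∈ ℝ² with |y| ≥ 1, one has dist((x, y), V) ≤ 2·‖(x, y)‖·|f(x, y)|. -/
open Filter Metric Real

/-- Two points of the plane on a common horizontal line are at distance the difference of their
first coordinates. -/
lemma EuclideanSpace.dist_vec_two_same_snd (p : EuclideanSpace ℝ (Fin 2)) (a : ℝ) :
    dist p !₂[a, p 1] = |p 0 - a| := by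
  simp [EuclideanSpace.dist_eq, Fin.sum_univ_two, Real.dist_eq, Real.sqrt_sq_eq_abs]

/-- For the Broughton polynomial `f(x,y) = x(xy − 1)` and `V = f⁻¹(0)`:
if `|y| ≥ 1` then `dist((x,y), V) ≤ 2 ‖(x,y)‖ |f(x,y)|`. -/
theorem broughton_dist_le_of_abs_snd_ge_one :
    ∀ p : EuclideanSpace ℝ (Fin 2), 1 ≤ |p 1| →
      Metric.infDist p {q : EuclideanSpace ℝ (Fin 2) | q 0 * (q 0 * q 1 - 1) = 0}
        ≤ 2 * (‖p‖ * |p 0 * (p 0 * p 1 - 1)|) := by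
  intro p hp
  have hnorm : 1 ≤ ‖p‖ := hp.trans (PiLp.norm_apply_le p 1)
  have hy : p 1 ≠ 0 := abs_pos.mp (one_pos.trans_le hp)
  have key (a : ℝ) (ha : a * (a * p 1 - 1) = 0)
      (h : |p 0 - a| ≤ 2 * |p 0 * (p 0 * p 1 - 1)|) :
      Metric.infDist p {q : EuclideanSpace ℝ (Fin 2) | q 0 * (q 0 * q 1 - 1) = 0}
        ≤ 2 * (‖p‖ * |p 0 * (p 0 * p 1 - 1)|) := by
    have hle := Metric.infDist_le_dist_of_mem (x := p) (y := !₂[a, p 1])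
      (s := {q : EuclideanSpace ℝ (Fin 2) | q 0 * (q 0 * q 1 - 1) = 0}) (by simpa using ha)
    rw [EuclideanSpace.dist_vec_two_same_snd] at hle
    have := le_mul_of_one_le_left (abs_nonneg (p 0 * (p 0 * p 1 - 1))) hnorm
    linarith
  rcases le_total (1 / 2) |p 0 * p 1| with hxy | hxy
  · refine key (1 / p 1) (by field_simp; simp) ?_
    have hsub : p 0 - 1 / p 1 = (p 0 * p 1 - 1) / p 1 := by field_simp
    rw [hsub, abs_div, div_le_iff₀ (abs_pos.mpr hy), abs_mul]
    rw [abs_mul] at hxy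
    nlinarith [abs_nonneg (p 0 * p 1 - 1)]
  · refine key 0 (by simp) ?_
    have h1 : 1 / 2 ≤ |p 0 * p 1 - 1| := by
      have := (abs_le.mp hxy).2
      rw [abs_sub_comm]
      exact le_trans (by linarith) (le_abs_self _)
    rw [sub_zero, abs_mul]
    nlinarith [abs_nonneg (p 0)]
end

section
/- Let f : ℝ² → ℝ be the Broughton polynomial f(x, y) := x(xy − 1) and V := f⁻¹(0). Then there exist constants α > 0 and c > 0 such that |f(x, y)|^α + ‖(x, y)‖·|f(x, y)| ≥ c·dist((x, y), V) for all (x, y) ∈ ℝ². (In fact one can take α = 1/18 and c = min{c₁, 1/2} where c₁ is the constant from the local Łojasiewicz inequality on the square |x| ≤ 1, |y| ≤ 1.) -/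
open Filter Metric Real

/-- The distance to the zero fibre of the Broughton polynomial, cubed, is at most `|f|`: one compares
with the points `(0, y)` and `(x, 1 / x)` of the fibre. -/
theorem infDist_broughton_pow_three_le (p : EuclideanSpace ℝ (Fin 2)) :
    Metric.infDist p {q : EuclideanSpace ℝ (Fin 2) | q 0 * (q 0 * q 1 - 1) = 0} ^ 3
      ≤ |p 0 * (p 0 * p 1 - 1)| := by
  set V := {q : EuclideanSpace ℝ (Fin 2) | q 0 * (q 0 * q 1 - 1) = 0} with hV
  have d_nonneg : 0 ≤ infDist p V := infDist_nonneg
  have horizontal : infDist p V ≤ |p 0| := by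
    have hmem : (!₂[0, p 1] : EuclideanSpace ℝ (Fin 2)) ∈ V := by simp [hV]
    refine (infDist_le_dist_of_mem hmem).trans_eq ?_
    simp [EuclideanSpace.dist_eq, Fin.sum_univ_two, Real.dist_eq, Real.sqrt_sq_eq_abs]
  rcases eq_or_ne (p 0) 0 with hx | hx
  · have hd : infDist p V = 0 := le_antisymm (by simpa [hx] using horizontal) d_nonneg
    simp [hd, hx]
  have vertical : infDist p V ≤ |p 1 - (p 0)⁻¹| := by
    have hmem : (!₂[p 0, (p 0)⁻¹] : EuclideanSpace ℝ (Fin 2)) ∈ V := by simp [hV, hx]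
    refine (infDist_le_dist_of_mem hmem).trans_eq ?_
    simp [EuclideanSpace.dist_eq, Fin.sum_univ_two, Real.dist_eq, Real.sqrt_sq_eq_abs]
  calc infDist p V ^ 3 = infDist p V ^ 2 * infDist p V := pow_succ _ _
    _ ≤ |p 0| ^ 2 * |p 1 - (p 0)⁻¹| := by gcongr
    _ = |p 0 * (p 0 * p 1 - 1)| := by
      rw [← abs_pow, ← abs_mul]
      congr 1
      field_simp

/-- The mixed Łojasiewicz inequality holds for the Broughton polynomial
`f(x,y) = x(xy − 1)` at the value `t = 0` (even though `0 ∈ K∞(f)`):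
there are `α > 0` and `c > 0` with
`|f p| ^ α + ‖p‖ |f p| ≥ c dist(p, f⁻¹(0))` for all `p ∈ ℝ²`. -/
theorem broughton_mixed_lojasiewicz :
    ∃ α : ℝ, 0 < α ∧ ∃ c : ℝ, 0 < c ∧ ∀ p : EuclideanSpace ℝ (Fin 2),
      c * Metric.infDist p {q : EuclideanSpace ℝ (Fin 2) | q 0 * (q 0 * q 1 - 1) = 0}
        ≤ |p 0 * (p 0 * p 1 - 1)| ^ α + ‖p‖ * |p 0 * (p 0 * p 1 - 1)| := by
  refine ⟨((3 : ℕ) : ℝ)⁻¹, by norm_num, 1, one_pos, fun p => ?_⟩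
  rw [one_mul]
  refine le_add_of_le_of_nonneg ?_ (by positivity)
  rw [← Real.pow_rpow_inv_natCast infDist_nonneg three_ne_zero]
  exact Real.rpow_le_rpow (pow_nonneg infDist_nonneg 3) (infDist_broughton_pow_three_le p)
    (by positivity)
end

section
/- Let f : ℝ³ → ℝ be the polynomial f(x, y, z) := z(x⁴ + (xy − 1)²) and V := f⁻¹(0) = { (x, y, z) ∈ ℝ³ : z = 0 }. Then there are no constants α > 0 and c > 0 such that |f(X)|^α + ‖X‖·|f(X)| ≥ c·dist(X, V) for all X ∈ ℝ³. -/
open Filter Metric Real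

/-- The polynomial `x⁴ + (xy − 1)²` is positive on `ℝ²`. -/
theorem pow_four_add_mul_sub_one_sq_pos (x y : ℝ) : 0 < x ^ 4 + (x * y - 1) ^ 2 := by
  rcases eq_or_ne x 0 with rfl | hx
  · norm_num
  · positivity

/-- The distance from `X` to a coordinate hyperplane is at least the size of that coordinate. -/
theorem abs_apply_le_infDist_setOf_apply_eq_zero {ι : Type*} [Fintype ι] (i : ι)
    (X : EuclideanSpace ℝ ι) :
    |X i| ≤ Metric.infDist X {Y : EuclideanSpace ℝ ι | Y i = 0} := by
  refine (Metric.le_infDist ⟨0, by simp⟩).2 fun Y hY => ?_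
  have hY' : Y i = 0 := hY
  simpa [dist_eq_norm, hY'] using PiLp.norm_apply_le (X - Y) i

/-- A norm bound along the curve `s ↦ (1/s, s, s)`. -/
theorem norm_inv_self_self_le {s : ℝ} (hs : 1 ≤ s) : ‖!₂[s⁻¹, s, s]‖ ≤ 2 * s := by
  have h1 : s⁻¹ ≤ 1 := inv_le_one_of_one_le₀ hs
  have h0 : 0 ≤ s⁻¹ := by positivity
  rw [EuclideanSpace.norm_eq]
  refine Real.sqrt_le_iff.2 ⟨by positivity, ?_⟩
  simp only [Fin.sum_univ_three, Real.norm_eq_abs, sq_abs]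
  simp only [Matrix.cons_val]
  nlinarith

/-- For `f(x,y,z) = z(x⁴ + (xy − 1)²)`, the zero set `V = f⁻¹(0)` is the plane
`{z = 0}`, and there are no constants `α > 0`, `c > 0` such that
`|f X| ^ α + ‖X‖ |f X| ≥ c dist(X, V)` for all `X ∈ ℝ³`. -/
theorem no_mixed_lojasiewicz_example :
    ∀ (f : EuclideanSpace ℝ (Fin 3) → ℝ),
      (f = fun p => p 2 * ((p 0) ^ 4 + (p 0 * p 1 - 1) ^ 2)) →
      {X : EuclideanSpace ℝ (Fin 3) | f X = 0} = {X | X 2 = 0} ∧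
      ¬ ∃ α : ℝ, 0 < α ∧ ∃ c : ℝ, 0 < c ∧ ∀ X : EuclideanSpace ℝ (Fin 3),
        c * Metric.infDist X {X : EuclideanSpace ℝ (Fin 3) | f X = 0}
          ≤ |f X| ^ α + ‖X‖ * |f X| := by
  rintro f rfl
  have hV : {X : EuclideanSpace ℝ (Fin 3) |
      X 2 * ((X 0) ^ 4 + (X 0 * X 1 - 1) ^ 2) = 0} = {X | X 2 = 0} := by
    ext X
    simp [(pow_four_add_mul_sub_one_sq_pos (X 0) (X 1)).ne']
  refine ⟨hV, ?_⟩
  rintro ⟨α, hα, c, hc, h⟩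
  simp only [hV] at h
  obtain ⟨s, hs⟩ : ∃ s : ℝ, s = 1 + 3 / c := ⟨_, rfl⟩
  have hs1 : 1 ≤ s := by rw [hs]; linarith [div_pos three_pos hc]
  have hs0 : 0 < s := by linarith
  have hcs : c * s = c + 3 := by rw [hs]; field_simp
  have hX := h !₂[s⁻¹, s, s]
  have hd := abs_apply_le_infDist_setOf_apply_eq_zero 2 !₂[s⁻¹, s, s]
  have hn := norm_inv_self_self_le hs1
  have hf : s * (s⁻¹ ^ 4 + (s⁻¹ * s - 1) ^ 2) = s⁻¹ ^ 3 := by field_simp; ring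
  simp only [Matrix.cons_val] at hX hd
  rw [hf, abs_of_pos (by positivity)] at hX
  rw [abs_of_pos hs0] at hd
  have hinv : s⁻¹ ≤ 1 := inv_le_one_of_one_le₀ hs1
  have hpow : (s⁻¹ ^ 3) ^ α ≤ 1 :=
    Real.rpow_le_one (by positivity) (pow_le_one₀ (by positivity) hinv) hα.le
  have hmul : ‖!₂[s⁻¹, s, s]‖ * s⁻¹ ^ 3 ≤ 2 :=
    calc ‖!₂[s⁻¹, s, s]‖ * s⁻¹ ^ 3 ≤ 2 * s * s⁻¹ ^ 3 := by gcongr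
      _ = 2 * s⁻¹ ^ 2 := by field_simp
      _ ≤ 2 := by linarith [pow_le_one₀ (n := 2) (by positivity : 0 ≤ s⁻¹) hinv]
  linarith [mul_le_mul_of_nonneg_left hd hc.le]
end

section
/- Let f : ℝ² → ℝ be defined by f(x, y) := x/√(y² + 1) and let t := 2, V_t := f⁻¹(2). Then for every β < 1 there are no constants α > 0 and c > 0 such that |f(x, y) − 2|^α + ‖(x, y)‖^β·|f(x, y) − 2| ≥ c·dist((x, y), V_t) for all (x, y) ∈ ℝ². (In particular, the exponent 1 on ‖x‖ in the mixed Łojasiewicz inequality cannot be lowered, even though K∞(f) = ∅.) -/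
open Filter Metric Real

/-- A point `(a, b)` with `a = √(b² + 1)` lies at distance at least `a / 3` from
`{(x, y) | x = 2 √(y² + 1)}`. -/
lemma le_three_mul_dist_of_sqrt {p q : EuclideanSpace ℝ (Fin 2)}
    (hp : p 0 = √((p 1) ^ 2 + 1)) (hq : q 0 = 2 * √((q 1) ^ 2 + 1)) :
    p 0 ≤ 3 * dist p q := by
  have h0 : |p 0 - q 0| ≤ dist p q := by
    simpa [dist_eq_norm] using PiLp.norm_apply_le (p - q) 0
  have h1 : |p 1 - q 1| ≤ dist p q := by
    simpa [dist_eq_norm] using PiLp.norm_apply_le (p - q) 1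
  have hlip : √((p 1) ^ 2 + 1) ≤ √((q 1) ^ 2 + 1) + |p 1 - q 1| := by
    apply Real.sqrt_le_iff.mpr
    refine ⟨by positivity, ?_⟩
    have hs := Real.sq_sqrt (show 0 ≤ (q 1) ^ 2 + 1 by positivity)
    have hle : |q 1| ≤ √((q 1) ^ 2 + 1) := Real.abs_le_sqrt (by linarith)
    have hmul : q 1 * (p 1 - q 1) ≤ √((q 1) ^ 2 + 1) * |p 1 - q 1| :=
      (le_abs_self _).trans (by rw [abs_mul]; gcongr)
    nlinarith [sq_abs (p 1 - q 1)]
  have := neg_abs_le (p 0 - q 0)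
  linarith

/-- For `f(x,y) = x / √(y² + 1)` and `t = 2`: for every `β < 1` there are no
constants `α > 0`, `c > 0` such that
`|f(x,y) − 2| ^ α + ‖(x,y)‖ ^ β |f(x,y) − 2| ≥ c dist((x,y), f⁻¹(2))`
for all `(x,y) ∈ ℝ²`. The exponent `1` on `‖x‖` cannot be lowered. -/
theorem no_lower_exponent_example :
    ∀ (f : EuclideanSpace ℝ (Fin 2) → ℝ),
      (f = fun p => p 0 / Real.sqrt ((p 1) ^ 2 + 1)) →
      ∀ β : ℝ, β < 1 →
      ¬ ∃ α : ℝ, 0 < α ∧ ∃ c : ℝ, 0 < c ∧ ∀ p : EuclideanSpace ℝ (Fin 2),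
        c * Metric.infDist p {q : EuclideanSpace ℝ (Fin 2) | f q = 2}
          ≤ |f p - 2| ^ α + ‖p‖ ^ β * |f p - 2| := by
  rintro f rfl β hβ ⟨α, -, c, hc, h⟩
  have hlim : Tendsto (fun r : ℝ => r⁻¹ + r ^ (-(1 - β))) atTop (nhds 0) := by
    simpa using tendsto_inv_atTop_zero.add (tendsto_rpow_neg_atTop (sub_pos.mpr hβ))
  obtain ⟨r, hr, hr1⟩ :=
    ((hlim.eventually_lt_const (show 0 < c / 6 by positivity)).and
      (eventually_ge_atTop 1)).exists
  have hr0 : 0 < r := by linarith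
  have hb : √((r ^ 2 - 1) / 2) ^ 2 = (r ^ 2 - 1) / 2 := Real.sq_sqrt (by nlinarith)
  have ha : √((r ^ 2 + 1) / 2) ^ 2 = (r ^ 2 + 1) / 2 := Real.sq_sqrt (by positivity)
  have hapos : 0 < √((r ^ 2 + 1) / 2) := by positivity
  set p : EuclideanSpace ℝ (Fin 2) := !₂[√((r ^ 2 + 1) / 2), √((r ^ 2 - 1) / 2)] with hpdef
  have hp0 : p 0 = √((r ^ 2 + 1) / 2) := rfl
  have hp1 : p 1 = √((r ^ 2 - 1) / 2) := rfl
  have hp : p 0 = √((p 1) ^ 2 + 1) := by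
    rw [hp0, hp1, hb]; congr 1; ring
  have hnorm : ‖p‖ = r := by
    rw [EuclideanSpace.norm_eq, Fin.sum_univ_two, hp0, hp1, Real.norm_eq_abs, Real.norm_eq_abs,
      sq_abs, sq_abs, ha, hb, Real.sqrt_eq_iff_mul_self_eq_of_pos hr0]
    ring
  have hdist : r / 6 ≤ infDist p {q : EuclideanSpace ℝ (Fin 2) |
      q 0 / √((q 1) ^ 2 + 1) = 2} := by
    refine (le_infDist ⟨!₂[2, 0], by simp⟩).mpr fun q hq => ?_
    have hq' : q 0 = 2 * √((q 1) ^ 2 + 1) := (div_eq_iff (by positivity)).mp hq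
    have := le_three_mul_dist_of_sqrt hp hq'
    have : r ≤ 2 * p 0 := by rw [hp0]; nlinarith
    linarith
  have hfp : p 0 / √((p 1) ^ 2 + 1) = 1 := by
    rw [← hp]; exact div_self (by rw [hp0]; exact hapos.ne')
  have key := h p
  simp only [hfp, hnorm] at key
  norm_num at key
  have hmul : r * (r⁻¹ + r ^ (-(1 - β))) = 1 + r ^ β := by
    rw [mul_add, mul_inv_cancel₀ hr0.ne', neg_sub, Real.rpow_sub_one hr0.ne',
      mul_div_cancel₀ _ hr0.ne']
  have h1 := mul_lt_mul_of_pos_left hr hr0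
  have h2 := mul_le_mul_of_nonneg_left hdist hc.le
  linarith
end

section
/- Let f : ℝ² → ℝ be defined by f(x, y) := x/(y² + 1). Then for every t ∈ ℝ there are no positive constants c, α, β such that |f(x, y) − t|^α + |f(x, y) − t|^β ≥ c·dist((x, y), { f = t }) for all (x, y) ∈ ℝ²; that is, E(f) = ℝ. -/
open Filter Metric Real

/-- For `f(x,y) = x / (y² + 1)`, every `t ∈ ℝ` fails the global Łojasiewicz
inequality: there are no positive constants `c`, `α`, `β` with
`|f(x,y) − t| ^ α + |f(x,y) − t| ^ β ≥ c dist((x,y), f⁻¹(t))` for all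
`(x,y) ∈ ℝ²`; that is, `E(f) = ℝ`. -/
theorem E_eq_univ_example :
    ∀ (f : EuclideanSpace ℝ (Fin 2) → ℝ),
      (f = fun p => p 0 / ((p 1) ^ 2 + 1)) →
      ∀ t : ℝ,
      ¬ ∃ c : ℝ, 0 < c ∧ ∃ α : ℝ, 0 < α ∧ ∃ β : ℝ, 0 < β ∧
        ∀ p : EuclideanSpace ℝ (Fin 2),
          c * Metric.infDist p {q : EuclideanSpace ℝ (Fin 2) | f q = t}
            ≤ |f p - t| ^ α + |f p - t| ^ β := by
  rintro f rfl t ⟨c, hc, α, -, β, -, h⟩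
  -- Along the level curve `f = t + 1` the left side is constant, the distance unbounded.
  set R : ℝ := 3 / c with hR
  have hRpos : 0 < R := by positivity
  set y : ℝ := 2 * |t| * R + R + 1 with hy
  have hp := h !₂[(t + 1) * (y ^ 2 + 1), y]
  have hval : (t + 1) * (y ^ 2 + 1) / (y ^ 2 + 1) - t = 1 := by
    field_simp
    ring
  simp only [Matrix.cons_val_zero, Matrix.cons_val_one, hval, abs_one,
    Real.one_rpow] at hp
  have hne : {q : EuclideanSpace ℝ (Fin 2) | q 0 / ((q 1) ^ 2 + 1) = t}.Nonempty :=
    ⟨!₂[t, 0], by simp⟩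
  have hlt : Metric.infDist (!₂[(t + 1) * (y ^ 2 + 1), y] : EuclideanSpace ℝ (Fin 2))
      {q : EuclideanSpace ℝ (Fin 2) | q 0 / ((q 1) ^ 2 + 1) = t} < R := by
    rw [hR, lt_div_iff₀ hc]
    linarith
  obtain ⟨q, hq, hdist⟩ := (Metric.infDist_lt_iff hne).1 hlt
  rw [dist_eq_norm] at hdist
  have h0 := (PiLp.norm_apply_le _ 0).trans_lt hdist
  have h1 := (PiLp.norm_apply_le _ 1).trans_lt hdist
  simp only [PiLp.sub_apply, Matrix.cons_val_zero, Matrix.cons_val_one,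
    Real.norm_eq_abs] at h0 h1
  have hq0 : q 0 = t * ((q 1) ^ 2 + 1) := (div_eq_iff (by positivity)).1 hq
  have hypos : 0 < y := by positivity
  have hsq : |y ^ 2 - (q 1) ^ 2| ≤ R * (2 * y + R) := by
    rw [sq_sub_sq, abs_mul, mul_comm]
    have hsum : |y + q 1| ≤ 2 * y + R := by
      rw [abs_lt] at h1
      rw [abs_le]
      constructor <;> linarith
    exact mul_le_mul h1.le hsum (abs_nonneg _) hRpos.le
  have ht : -(|t| * (R * (2 * y + R))) ≤ t * (y ^ 2 - (q 1) ^ 2) := by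
    refine le_trans ?_ (neg_abs_le _)
    rw [abs_mul]
    gcongr
  have hgrow : |t| * (R * (2 * y + R)) + R < y ^ 2 + 1 := by
    have ha := abs_nonneg t
    have : y ^ 2 + 1 - |t| * (R * (2 * y + R)) - R
        = |t| * R ^ 2 + 2 * (|t| * R) + R ^ 2 + R + 2 := by
      rw [hy]
      ring
    have : 0 < |t| * R ^ 2 + 2 * (|t| * R) + R ^ 2 + R + 2 := by positivity
    linarith
  have hx := (abs_lt.1 h0).2
  rw [hq0] at hx
  linarith
end
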